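/- Symmetry of the linearized Bach tensor: for n = 4 and every smooth symmetric field h_{μν} : ℝ^4 → ℝ, the linearized Bach tensor is symmetric: ℬ^{αβ}[h](x) = ℬ^{βα}[h](x) for all α,β and all x ∈ ℝ^4. -/

import Mathlib

noncomputable section

open MeasureTheory

/-- Minkowski metric `diag(-1,1,…,1)` on `Fin n`. -/
def eta (n : ℕ) (μ ν : Fin n) : ℝ :=
  if μ = ν then (if (μ : ℕ) = 0 then -1 else 1) else 0

/-- Partial derivative in the coordinate direction `μ`. -/
def pd {n : ℕ} (μ : Fin n) (f : (Fin n → ℝ) → ℝ) : (Fin n → ℝ) → ℝ :=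
  fun x => fderiv ℝ f x (Pi.single μ 1)

/-- A rank-2 covariant field on `ℝ^n`. -/
abbrev TensorField (n : ℕ) := Fin n → Fin n → (Fin n → ℝ) → ℝ

/-- Linearized Riemann tensor
`ℛ_{αβγδ}[h] = −(1/2)(∂_α∂_γ h_{βδ} + ∂_β∂_δ h_{αγ} − ∂_α∂_δ h_{βγ} − ∂_β∂_γ h_{αδ})`. -/
def Riem {n : ℕ} (h : TensorField n) (α β γ δ : Fin n) : (Fin n → ℝ) → ℝ :=
  fun x => -(1/2) * (pd α (pd γ (h β δ)) x + pd β (pd δ (h α γ)) x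
    - pd α (pd δ (h β γ)) x - pd β (pd γ (h α δ)) x)

/-- Linearized Ricci tensor
`ℛ_{μν}[h] = (1/2) η^{αλ}(∂_μ∂_α h_{λν} − ∂_λ∂_α h_{μν} − ∂_μ∂_ν h_{λα} + ∂_λ∂_ν h_{μα})`. -/
def Ricci {n : ℕ} (h : TensorField n) (μ ν : Fin n) : (Fin n → ℝ) → ℝ :=
  fun x => (1/2) * ∑ α, ∑ l, eta n α l *
    (pd μ (pd α (h l ν)) x - pd l (pd α (h μ ν)) x
      - pd μ (pd ν (h l α)) x + pd l (pd ν (h μ α)) x)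

/-- Linearized scalar curvature `ℛ[h] = η^{αλ}η^{μν}(∂_λ∂_ν h_{μα} − ∂_α∂_λ h_{μν})`. -/
def Scal {n : ℕ} (h : TensorField n) : (Fin n → ℝ) → ℝ :=
  fun x => ∑ α, ∑ l, ∑ μ, ∑ ν, eta n α l * eta n μ ν *
    (pd l (pd ν (h μ α)) x - pd α (pd l (h μ ν)) x)

/-- Linearized Schouten-type tensor
`𝒦_{μν}[h] = (1/(n−2))(ℛ_{μν}[h] − η_{μν}ℛ[h]/(2(n−1)))`. -/
def Kt {n : ℕ} (h : TensorField n) (μ ν : Fin n) : (Fin n → ℝ) → ℝ :=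
  fun x => (1 / ((n : ℝ) - 2)) *
    (Ricci h μ ν x - eta n μ ν * Scal h x / (2 * ((n : ℝ) - 1)))

/-- Linearized Weyl tensor
`𝒲_{αβγδ}[h] = ℛ_{αβγδ}[h] − η_{αγ}𝒦_{δβ}[h] + η_{αδ}𝒦_{γβ}[h] + η_{βγ}𝒦_{δα}[h] − η_{βδ}𝒦_{γα}[h]`. -/
def Weyl {n : ℕ} (h : TensorField n) (α β γ δ : Fin n) : (Fin n → ℝ) → ℝ :=
  fun x => Riem h α β γ δ x - eta n α γ * Kt h δ β x + eta n α δ * Kt h γ β x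
    + eta n β γ * Kt h δ α x - eta n β δ * Kt h γ α x

/-- Linearized Cotton tensor `𝒞_{αβμ}[h] = ∂_μ𝒦_{βα}[h] − ∂_β𝒦_{μα}[h]`. -/
def Cotton {n : ℕ} (h : TensorField n) (α β μ : Fin n) : (Fin n → ℝ) → ℝ :=
  fun x => pd μ (Kt h β α) x - pd β (Kt h μ α) x

/-- Cotton tensor with all indices raised:
`𝒞^{αβρ}[h] = η^{αα'}η^{ββ'}η^{ρρ'}𝒞_{α'β'ρ'}[h]`. -/
def CottonUp {n : ℕ} (h : TensorField n) (α β ρ : Fin n) : (Fin n → ℝ) → ℝ :=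
  fun x => ∑ α', ∑ β', ∑ ρ', eta n α α' * eta n β β' * eta n ρ ρ' * Cotton h α' β' ρ' x

/-- Linearized Bach tensor `ℬ^{αβ}[h] = −2∂_ρ𝒞^{αβρ}[h]`. -/
def Bach {n : ℕ} (h : TensorField n) (α β : Fin n) : (Fin n → ℝ) → ℝ :=
  fun x => -2 * ∑ ρ, pd ρ (CottonUp h α β ρ) x

open scoped ContDiff

section PartialDerivative

variable {n : ℕ} {f g : (Fin n → ℝ) → ℝ}

theorem ContDiff.pd (hf : ContDiff ℝ ∞ f) (μ : Fin n) : ContDiff ℝ ∞ (pd μ f) :=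
  (hf.fderiv_right (m := ∞) le_rfl).clm_apply contDiff_const

theorem pd_add (μ : Fin n) (hf : ContDiff ℝ ∞ f) (hg : ContDiff ℝ ∞ g) (x : Fin n → ℝ) :
    pd μ (fun y => f y + g y) x = pd μ f x + pd μ g x := by
  simp only [pd]
  rw [fderiv_fun_add (hf.differentiable (by simp) x) (hg.differentiable (by simp) x)]
  rfl

theorem pd_sub (μ : Fin n) (hf : ContDiff ℝ ∞ f) (hg : ContDiff ℝ ∞ g) (x : Fin n → ℝ) :
    pd μ (fun y => f y - g y) x = pd μ f x - pd μ g x := by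
  simp only [pd]
  rw [fderiv_fun_sub (hf.differentiable (by simp) x) (hg.differentiable (by simp) x)]
  rfl

theorem pd_const_mul (μ : Fin n) (c : ℝ) (hf : ContDiff ℝ ∞ f) (x : Fin n → ℝ) :
    pd μ (fun y => c * f y) x = c * pd μ f x := by
  simp only [pd]
  rw [fderiv_const_mul (hf.differentiable (by simp) x)]
  rfl

theorem pd_sum {ι : Type*} [Fintype ι] (μ : Fin n) {F : ι → (Fin n → ℝ) → ℝ}
    (hF : ∀ i, ContDiff ℝ ∞ (F i)) (x : Fin n → ℝ) :
    pd μ (fun y => ∑ i, F i y) x = ∑ i, pd μ (F i) x := by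
  simp only [pd]
  rw [fderiv_fun_sum fun i _ => (hF i).differentiable (by simp) x]
  simp

theorem pd_comm (μ ν : Fin n) (hf : ContDiff ℝ ∞ f) : pd μ (pd ν f) = pd ν (pd μ f) := by
  have hd : ∀ x, DifferentiableAt ℝ (fderiv ℝ f) x := fun x =>
    (hf.fderiv_right (m := ∞) le_rfl).differentiable (by simp) x
  have key : ∀ (a b : Fin n) (x), pd a (pd b f) x =
      fderiv ℝ (fderiv ℝ f) x (Pi.single a 1) (Pi.single b 1) := fun a b x => by
    unfold pd
    rw [fderiv_clm_apply (hd x) (differentiableAt_const _)]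
    simp
  ext x
  rw [key, key]
  exact (hf.contDiffAt.isSymmSndFDerivAt
    (by simpa using WithTop.coe_le_coe.2 (le_top : (2 : ℕ∞) ≤ ⊤))) _ _

end PartialDerivative

section Curvature

variable {n : ℕ} {h : TensorField n}

theorem sum_eta_mul (μ : Fin n) (F : Fin n → ℝ) :
    ∑ ν, eta n μ ν * F ν = eta n μ μ * F μ := by
  rw [Finset.sum_eq_single μ _ (by simp)]
  intro ν _ hν
  simp [eta, hν.symm]

theorem eta_comm (μ ν : Fin n) : eta n μ ν = eta n ν μ := by
  by_cases hμν : μ = ν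
  · rw [hμν]
  · simp [eta, hμν, Ne.symm hμν]

theorem ricci_apply (h : TensorField n) (μ ν : Fin n) (x : Fin n → ℝ) :
    Ricci h μ ν x = (1 / 2) * ∑ l, eta n l l *
      (pd μ (pd l (h l ν)) x - pd l (pd l (h μ ν)) x
        - pd μ (pd ν (h l l)) x + pd l (pd ν (h μ l)) x) := by
  simp only [Ricci, sum_eta_mul]

theorem scal_apply (h : TensorField n) (x : Fin n → ℝ) :
    Scal h x = ∑ l, eta n l l * ∑ μ, eta n μ μ *
      (pd l (pd μ (h μ l)) x - pd l (pd l (h μ μ)) x) := by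
  simp only [Scal, mul_assoc, ← Finset.mul_sum, sum_eta_mul]

theorem contDiff_ricci (hs : ∀ μ ν, ContDiff ℝ ∞ (h μ ν)) (μ ν : Fin n) :
    ContDiff ℝ ∞ (Ricci h μ ν) := by
  rw [funext (ricci_apply h μ ν)]
  exact contDiff_const.mul <| ContDiff.sum fun l _ => contDiff_const.mul <|
    (((((hs _ _).pd _).pd _).sub (((hs _ _).pd _).pd _)).sub (((hs _ _).pd _).pd _)).add
      (((hs _ _).pd _).pd _)

theorem contDiff_scal (hs : ∀ μ ν, ContDiff ℝ ∞ (h μ ν)) : ContDiff ℝ ∞ (Scal h) := by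
  rw [funext (scal_apply h)]
  exact ContDiff.sum fun l _ => contDiff_const.mul <| ContDiff.sum fun μ _ =>
    contDiff_const.mul <| (((hs _ _).pd _).pd _).sub (((hs _ _).pd _).pd _)

theorem ricci_comm (hs : ∀ μ ν, ContDiff ℝ ∞ (h μ ν)) (hsym : ∀ μ ν, h μ ν = h ν μ)
    (μ ν : Fin n) : Ricci h μ ν = Ricci h ν μ := by
  ext x
  rw [ricci_apply, ricci_apply]
  congr 1
  refine Finset.sum_congr rfl fun l _ => ?_
  rw [hsym l ν, hsym μ ν, hsym μ l, pd_comm μ ν (hs l l), pd_comm μ l (hs ν l),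
    pd_comm l ν (hs l μ)]
  ring

/-- The contracted Bianchi identity `∂^ρ ℛ_{ρα} = (1/2) ∂_α ℛ`. -/
theorem divergence_ricci (hs : ∀ μ ν, ContDiff ℝ ∞ (h μ ν)) (α : Fin n) (x : Fin n → ℝ) :
    ∑ ρ, eta n ρ ρ * pd ρ (Ricci h ρ α) x = (1 / 2) * pd α (Scal h) x := by
  have hd : ∀ a b μ ν, ContDiff ℝ ∞ (pd a (pd b (h μ ν))) := fun a b μ ν =>
    ((hs μ ν).pd b).pd a
  have hR : ∀ ρ, pd ρ (Ricci h ρ α) x = (1 / 2) * ∑ l, eta n l l *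
      (pd ρ (pd ρ (pd l (h l α))) x - pd ρ (pd l (pd l (h ρ α))) x
        - pd ρ (pd ρ (pd α (h l l))) x + pd ρ (pd l (pd α (h ρ l))) x) := by
    intro ρ
    have h1 : ∀ l, ContDiff ℝ ∞ fun y =>
        pd ρ (pd l (h l α)) y - pd l (pd l (h ρ α)) y := fun l => (hd _ _ _ _).sub (hd _ _ _ _)
    have h2 : ∀ l, ContDiff ℝ ∞ fun y =>
        pd ρ (pd l (h l α)) y - pd l (pd l (h ρ α)) y - pd ρ (pd α (h l l)) y :=
      fun l => (h1 l).sub (hd _ _ _ _)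
    have h3 : ∀ l, ContDiff ℝ ∞ fun y =>
        pd ρ (pd l (h l α)) y - pd l (pd l (h ρ α)) y - pd ρ (pd α (h l l)) y
          + pd l (pd α (h ρ l)) y := fun l => (h2 l).add (hd _ _ _ _)
    have h4 := fun l => (contDiff_const (c := eta n l l)).mul (h3 l)
    rw [funext (ricci_apply h ρ α), pd_const_mul _ _ (ContDiff.sum fun l _ => h4 l), pd_sum _ h4]
    congr 1
    refine Finset.sum_congr rfl fun l _ => ?_
    rw [pd_const_mul _ _ (h3 l), pd_add _ (h2 l) (hd _ _ _ _), pd_sub _ (h1 l) (hd _ _ _ _),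
      pd_sub _ (hd _ _ _ _) (hd _ _ _ _)]
  have hS : pd α (Scal h) x = ∑ l, eta n l l * ∑ μ, eta n μ μ *
      (pd α (pd l (pd μ (h μ l))) x - pd α (pd l (pd l (h μ μ))) x) := by
    have h1 : ∀ l μ, ContDiff ℝ ∞ fun y =>
        pd l (pd μ (h μ l)) y - pd l (pd l (h μ μ)) y := fun l μ => (hd _ _ _ _).sub (hd _ _ _ _)
    have h2 := fun l μ => (contDiff_const (c := eta n μ μ)).mul (h1 l μ)
    have h3 := fun l => ContDiff.sum (s := Finset.univ) fun μ _ => h2 l μ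
    rw [funext (scal_apply h), pd_sum _ fun l => (contDiff_const (c := eta n l l)).mul (h3 l)]
    refine Finset.sum_congr rfl fun l _ => ?_
    rw [pd_const_mul _ _ (h3 l), pd_sum _ (h2 l)]
    congr 1
    refine Finset.sum_congr rfl fun μ _ => ?_
    rw [pd_const_mul _ _ (h1 l μ), pd_sub _ (hd _ _ _ _) (hd _ _ _ _)]
  have hswap : ∑ ρ, ∑ l, eta n ρ ρ * eta n l l * pd ρ (pd l (pd l (h ρ α))) x =
      ∑ ρ, ∑ l, eta n ρ ρ * eta n l l * pd ρ (pd ρ (pd l (h l α))) x := by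
    rw [Finset.sum_comm]
    refine Finset.sum_congr rfl fun ρ _ => Finset.sum_congr rfl fun l _ => ?_
    rw [pd_comm l ρ ((hs l α).pd ρ), pd_comm l ρ (hs l α), mul_comm (eta n l l)]
  have hdiv : ∑ ρ, ∑ l, eta n ρ ρ * eta n l l * pd ρ (pd l (pd α (h ρ l))) x =
      ∑ l, ∑ μ, eta n l l * eta n μ μ * pd α (pd l (pd μ (h μ l))) x := by
    rw [Finset.sum_comm]
    refine Finset.sum_congr rfl fun l _ => Finset.sum_congr rfl fun ρ _ => ?_
    rw [pd_comm ρ l ((hs ρ l).pd α), pd_comm ρ α (hs ρ l), pd_comm l α ((hs ρ l).pd ρ),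
      mul_comm (eta n ρ ρ)]
  have hbox : ∑ ρ, ∑ l, eta n ρ ρ * eta n l l * pd ρ (pd ρ (pd α (h l l))) x =
      ∑ l, ∑ μ, eta n l l * eta n μ μ * pd α (pd l (pd l (h μ μ))) x := by
    refine Finset.sum_congr rfl fun ρ _ => Finset.sum_congr rfl fun l _ => ?_
    rw [pd_comm ρ α (hs l l), pd_comm ρ α ((hs l l).pd ρ)]
  have hL : ∑ ρ, eta n ρ ρ * pd ρ (Ricci h ρ α) x = (1 / 2) *
      (∑ ρ, ∑ l, eta n ρ ρ * eta n l l * pd ρ (pd ρ (pd l (h l α))) x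
        - ∑ ρ, ∑ l, eta n ρ ρ * eta n l l * pd ρ (pd l (pd l (h ρ α))) x
        - ∑ ρ, ∑ l, eta n ρ ρ * eta n l l * pd ρ (pd ρ (pd α (h l l))) x
        + ∑ ρ, ∑ l, eta n ρ ρ * eta n l l * pd ρ (pd l (pd α (h ρ l))) x) := by
    simp only [hR, ← Finset.sum_add_distrib, ← Finset.sum_sub_distrib, Finset.mul_sum]
    exact Finset.sum_congr rfl fun ρ _ => Finset.sum_congr rfl fun l _ => by ring
  rw [hL, hS, hswap, hdiv, hbox]
  simp only [Finset.mul_sum, ← Finset.sum_add_distrib, ← Finset.sum_sub_distrib]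
  exact Finset.sum_congr rfl fun ρ _ => Finset.sum_congr rfl fun l _ => by ring

theorem kt_apply (h : TensorField n) (μ ν : Fin n) (x : Fin n → ℝ) :
    Kt h μ ν x = (1 / ((n : ℝ) - 2)) *
      (Ricci h μ ν x - eta n μ ν / (2 * ((n : ℝ) - 1)) * Scal h x) := by
  simp only [Kt]
  ring

theorem contDiff_kt (hs : ∀ μ ν, ContDiff ℝ ∞ (h μ ν)) (μ ν : Fin n) :
    ContDiff ℝ ∞ (Kt h μ ν) := by
  rw [funext (kt_apply h μ ν)]
  exact contDiff_const.mul ((contDiff_ricci hs μ ν).sub (contDiff_const.mul (contDiff_scal hs)))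

theorem kt_comm (hs : ∀ μ ν, ContDiff ℝ ∞ (h μ ν)) (hsym : ∀ μ ν, h μ ν = h ν μ)
    (μ ν : Fin n) : Kt h μ ν = Kt h ν μ := by
  ext x
  rw [kt_apply, kt_apply, ricci_comm hs hsym μ ν, eta_comm μ ν]

theorem pd_kt (hs : ∀ μ ν, ContDiff ℝ ∞ (h μ ν)) (ρ μ ν : Fin n) (x : Fin n → ℝ) :
    pd ρ (Kt h μ ν) x = (1 / ((n : ℝ) - 2)) *
      (pd ρ (Ricci h μ ν) x - eta n μ ν / (2 * ((n : ℝ) - 1)) * pd ρ (Scal h) x) := by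
  have hS := (contDiff_const (c := eta n μ ν / (2 * ((n : ℝ) - 1)))).mul (contDiff_scal hs)
  rw [funext (kt_apply h μ ν), pd_const_mul _ _ ((contDiff_ricci hs μ ν).sub hS),
    pd_sub _ (contDiff_ricci hs μ ν) hS, pd_const_mul _ _ (contDiff_scal hs)]

theorem eta_mul_self (μ : Fin n) : eta n μ μ * eta n μ μ = 1 := by
  simp only [eta, if_true]
  split_ifs <;> norm_num

/-- The divergence `∂^ρ 𝒦_{ρα}` is a gradient. -/
theorem divergence_kt (hs : ∀ μ ν, ContDiff ℝ ∞ (h μ ν)) (α : Fin n) (x : Fin n → ℝ) :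
    ∑ ρ, eta n ρ ρ * pd ρ (Kt h ρ α) x =
      (1 / ((n : ℝ) - 2)) * (1 / 2 - 1 / (2 * ((n : ℝ) - 1))) * pd α (Scal h) x := by
  have htrace : ∑ ρ, eta n ρ ρ * (eta n ρ α * pd ρ (Scal h) x) = pd α (Scal h) x := by
    simp only [eta_comm _ α, mul_left_comm _ (eta n α _), sum_eta_mul]
    rw [← mul_assoc, eta_mul_self, one_mul]
  calc ∑ ρ, eta n ρ ρ * pd ρ (Kt h ρ α) x
      = (1 / ((n : ℝ) - 2)) * (∑ ρ, eta n ρ ρ * pd ρ (Ricci h ρ α) x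
          - 1 / (2 * ((n : ℝ) - 1)) * ∑ ρ, eta n ρ ρ * (eta n ρ α * pd ρ (Scal h) x)) := by
        simp only [Finset.mul_sum, ← Finset.sum_sub_distrib, pd_kt hs]
        exact Finset.sum_congr rfl fun ρ _ => by ring
    _ = _ := by
        rw [divergence_ricci hs, htrace]
        ring

theorem cottonUp_apply (h : TensorField n) (α β ρ : Fin n) (x : Fin n → ℝ) :
    CottonUp h α β ρ x = eta n α α * eta n β β * eta n ρ ρ * Cotton h α β ρ x := by
  simp only [CottonUp, mul_assoc, ← Finset.mul_sum, sum_eta_mul]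

/-- `ℬ^{αβ}` written as the wave operator applied to `𝒦` minus the Hessian of `ℛ`. -/
theorem bach_apply (hs : ∀ μ ν, ContDiff ℝ ∞ (h μ ν)) (α β : Fin n) (x : Fin n → ℝ) :
    Bach h α β x = -2 * (eta n α α * eta n β β *
      (∑ ρ, eta n ρ ρ * pd ρ (pd ρ (Kt h β α)) x
        - (1 / ((n : ℝ) - 2)) * (1 / 2 - 1 / (2 * ((n : ℝ) - 1))) *
          pd β (pd α (Scal h)) x)) := by
  have hK : ∀ ρ μ ν, ContDiff ℝ ∞ (pd ρ (Kt h μ ν)) := fun ρ μ ν => (contDiff_kt hs μ ν).pd ρ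
  have hC : ∀ ρ, pd ρ (CottonUp h α β ρ) x = eta n α α * eta n β β * eta n ρ ρ *
      (pd ρ (pd ρ (Kt h β α)) x - pd β (pd ρ (Kt h ρ α)) x) := by
    intro ρ
    have hCot : ContDiff ℝ ∞ (Cotton h α β ρ) := (hK ρ β α).sub (hK β ρ α)
    rw [funext (cottonUp_apply h α β ρ), pd_const_mul _ _ hCot, ← pd_comm ρ β (contDiff_kt hs ρ α),
      ← pd_sub _ (hK ρ β α) (hK β ρ α)]
    rfl
  have hdiv : ∑ ρ, eta n ρ ρ * pd β (pd ρ (Kt h ρ α)) x =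
      (1 / ((n : ℝ) - 2)) * (1 / 2 - 1 / (2 * ((n : ℝ) - 1))) * pd β (pd α (Scal h)) x := by
    rw [← pd_const_mul _ _ ((contDiff_scal hs).pd α), ← funext (divergence_kt hs α),
      pd_sum _ fun ρ => contDiff_const.mul (hK ρ ρ α)]
    exact Finset.sum_congr rfl fun ρ _ => (pd_const_mul _ _ (hK ρ ρ α) x).symm
  rw [← hdiv, ← Finset.sum_sub_distrib, Finset.mul_sum]
  simp only [Bach, hC]
  congr 1
  exact Finset.sum_congr rfl fun ρ _ => by ring

end Curvature

/-- symmetry of the linearized Bach tensor in four dimensions. -/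
theorem bach_tensor_symmetric
    (h : TensorField 4) (hsmooth : ∀ μ ν, ContDiff ℝ (⊤ : ℕ∞) (h μ ν))
    (hsym : ∀ μ ν, h μ ν = h ν μ) :
    ∀ (α β : Fin 4) (x : Fin 4 → ℝ),
      Bach h α β x = Bach h β α x := by
  intro α β x
  rw [bach_apply hsmooth, bach_apply hsmooth, kt_comm hsmooth hsym β α,
    pd_comm β α (contDiff_scal hsmooth), mul_comm (eta 4 α α)]
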